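/- Let N ∈ {1, 2}, α > 0, σ ≥ 1, and let 2 < r < ∞ with conjugate exponent r'. There exists a constant C_α > 0, depending only on N, σ, α and r, such that: for every Schwartz function v : ℝ^N → ℂ and every Schwartz function w : ℝ^N → ℝ satisfying w − α²Δw = |v|^σ pointwise on ℝ^N, and for all Schwartz functions v₁, v₂ : ℝ^N → ℂ, one has ‖w · |v|^{σ−1} v · (v₁ − v₂)‖_{L^{r'}} ≤ C_α ‖v‖_{H¹}^{2σ} ‖v₁ − v₂‖_{L^r}. -/

import Mathlib

open MeasureTheory Real Set
open scoped ENNReal NNReal ComplexConjugate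

noncomputable section

/-- Standard basis vector of `ℝ^N`. -/
def basisVec (N : ℕ) (i : Fin N) : EuclideanSpace ℝ (Fin N) :=
  EuclideanSpace.single i 1

/-- The Laplacian of a function on `ℝ^N`. -/
def lap {E : Type*} [NormedAddCommGroup E] [NormedSpace ℝ E]
    (N : ℕ) (u : EuclideanSpace ℝ (Fin N) → E) (x : EuclideanSpace ℝ (Fin N)) : E :=
  ∑ i : Fin N, fderiv ℝ (fun y => fderiv ℝ u y (basisVec N i)) x (basisVec N i)

/-- The `L^p` norm (with real exponent `p`) of a function on `ℝ^N`. -/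
def LpN (N : ℕ) {E : Type*} [NormedAddCommGroup E]
    (f : EuclideanSpace ℝ (Fin N) → E) (p : ℝ) : ℝ :=
  (eLpNorm f (ENNReal.ofReal p) volume).toReal

/-- The `L²` norm of the (total) derivative of a function on `ℝ^N`. -/
def gradL2 (N : ℕ) (v : EuclideanSpace ℝ (Fin N) → ℂ) : ℝ :=
  (eLpNorm (fun x => fderiv ℝ v x) 2 volume).toReal

/-- The `H¹` norm of a function on `ℝ^N`. -/
def H1norm (N : ℕ) (v : EuclideanSpace ℝ (Fin N) → ℂ) : ℝ :=
  Real.sqrt ((LpN N v 2) ^ 2 + (gradL2 N v) ^ 2)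

/-- The squared `H¹` norm, as an extended nonnegative real. -/
def sobolevEnergy {E : Type*} [NormedAddCommGroup E] [NormedSpace ℝ E] [MeasureSpace E]
    (v : E → ℂ) : ℝ≥0∞ :=
  (∫⁻ x, ‖v x‖ₑ ^ 2) + ∫⁻ x, ‖fderiv ℝ v x‖ₑ ^ 2

theorem sq_lintegral_mul_le {X : Type*} [MeasurableSpace X] {μ : Measure X} {f g : X → ℝ≥0∞}
    (hf : AEMeasurable f μ) (hg : AEMeasurable g μ) :
    (∫⁻ x, f x * g x ∂μ) ^ 2 ≤ (∫⁻ x, f x ^ 2 ∂μ) * ∫⁻ x, g x ^ 2 ∂μ := by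
  have h := ENNReal.lintegral_mul_le_Lp_mul_Lq μ Real.HolderConjugate.two_two hf hg
  have h2 : ∀ a : ℝ≥0∞, (a ^ (1 / 2 : ℝ)) ^ 2 = a := fun a => by
    rw [← ENNReal.rpow_natCast, ← ENNReal.rpow_mul]; norm_num
  calc (∫⁻ x, f x * g x ∂μ) ^ 2 ≤ _ := pow_le_pow_left' h 2
    _ = _ := by rw [mul_pow, h2, h2]; simp

theorem enorm_fderiv_pow_succ {E : Type*} [NormedAddCommGroup E] [NormedSpace ℝ E]
    {v : E → ℂ} {x : E} (hv : DifferentiableAt ℝ v x) (n : ℕ) :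
    ‖fderiv ℝ (fun y => v y ^ (n + 1)) x‖ₑ = (n + 1) * (‖v x‖ₑ ^ n * ‖fderiv ℝ v x‖ₑ) := by
  rw [fderiv_fun_pow (n + 1) hv, enorm_smul, nsmul_eq_mul, enorm_mul, Nat.add_sub_cancel, enorm_pow,
    mul_assoc]
  congr 1
  rw [← ofReal_norm, Complex.norm_natCast, ENNReal.ofReal_natCast]
  simp

theorem exists_lintegral_pow_step_of_two :
    ∃ C : ℝ≥0, ∀ (n : ℕ) (v : EuclideanSpace ℝ (Fin 2) → ℂ), ContDiff ℝ 1 v →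
      HasCompactSupport v →
      ∫⁻ x, ‖v x‖ₑ ^ (2 * (n + 1)) ≤
        (C * (n + 1) ^ 2 : ℝ≥0) * sobolevEnergy v * ∫⁻ x, ‖v x‖ₑ ^ (2 * n) := by
  refine ⟨lintegralPowLePowLIntegralFDerivConst
    (volume : Measure (EuclideanSpace ℝ (Fin 2))) 2, fun n v hv hc => ?_⟩
  have hp : Real.HolderConjugate (Module.finrank ℝ (EuclideanSpace ℝ (Fin 2))) 2 := by
    simpa using Real.HolderConjugate.two_two
  have hG := lintegral_pow_le_pow_lintegral_fderiv
    (volume : Measure (EuclideanSpace ℝ (Fin 2))) (hv.pow (n + 1))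
    (hc.comp_left (g := fun z : ℂ => z ^ (n + 1)) (by simp)) hp
  have hm : Measurable (fun x => ‖fderiv ℝ v x‖ₑ) :=
    (hv.continuous_fderiv one_ne_zero).enorm.measurable
  have hm' : Measurable (fun x => ‖v x‖ₑ ^ n) := hv.continuous.enorm.measurable.pow_const n
  simp_rw [enorm_fderiv_pow_succ (hv.differentiable one_ne_zero _), ENNReal.rpow_two] at hG
  rw [lintegral_const_mul' _ _ (by finiteness), mul_pow] at hG
  calc ∫⁻ x, ‖v x‖ₑ ^ (2 * (n + 1)) = ∫⁻ x, ‖v x ^ (n + 1)‖ₑ ^ 2 := by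
        simp_rw [enorm_pow, ← pow_mul, mul_comm 2]
    _ ≤ _ := hG
    _ ≤ _ * ((n + 1) ^ 2 * ((∫⁻ x, (‖v x‖ₑ ^ n) ^ 2) * ∫⁻ x, ‖fderiv ℝ v x‖ₑ ^ 2)) := by
        gcongr
        exact sq_lintegral_mul_le hm'.aemeasurable hm.aemeasurable
    _ ≤ _ * ((n + 1) ^ 2 * ((∫⁻ x, (‖v x‖ₑ ^ n) ^ 2) * sobolevEnergy v)) := by
        gcongr; exact le_add_self
    _ = _ := by
        push_cast
        simp_rw [← pow_mul, mul_comm n 2]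
        ring

theorem enorm_sq_le_sobolevEnergy_of_real {u : ℝ → ℂ} (hu : ContDiff ℝ 1 u)
    (hc : HasCompactSupport u) (t : ℝ) : ‖u t‖ₑ ^ 2 ≤ 2 * sobolevEnergy u := by
  have h := HasCompactSupport.enorm_le_lintegral_Ici_deriv (hu.pow 2)
    (hc.comp_left (g := fun z : ℂ => z ^ 2) (by simp)) t
  have hm : Measurable (fun x => ‖u x‖ₑ ^ 2) := hu.continuous.enorm.measurable.pow_const 2
  calc ‖u t‖ₑ ^ 2 = ‖u t ^ 2‖ₑ := by rw [enorm_pow]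
    _ ≤ _ := h
    _ ≤ ∫⁻ y, ‖deriv (fun x => u x ^ 2) y‖ₑ := setLIntegral_le_lintegral _ _
    _ ≤ ∫⁻ y, 2 * (‖u y‖ₑ ^ 2 + ‖fderiv ℝ u y‖ₑ ^ 2) := by
        refine lintegral_mono fun y => ?_
        have hd : ‖deriv (fun x => u x ^ 2) y‖ₑ = ‖fderiv ℝ (fun x => u x ^ 2) y‖ₑ := by
          simp [enorm_eq_iff_norm_eq, norm_deriv_eq_norm_fderiv]
        have := enorm_fderiv_pow_succ (hu.differentiable one_ne_zero y) 1
        norm_num at this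
        rw [hd, this]
        gcongr
        rcases le_total ‖u y‖ₑ ‖fderiv ℝ u y‖ₑ with h | h
        · exact (mul_le_mul_left h _).trans (by rw [← sq]; exact le_add_self)
        · exact (mul_le_mul_right h _).trans (by rw [← sq]; exact le_self_add)
    _ = _ := by
        rw [lintegral_const_mul' _ _ (by simp), lintegral_add_left hm]; rfl

theorem sobolevEnergy_comp_linearIsometryEquiv {E F : Type*} [NormedAddCommGroup E]
    [InnerProductSpace ℝ E] [FiniteDimensional ℝ E] [MeasurableSpace E] [BorelSpace E]
    [NormedAddCommGroup F] [InnerProductSpace ℝ F] [FiniteDimensional ℝ F] [MeasurableSpace F]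
    [BorelSpace F] (e : E ≃ₗᵢ[ℝ] F) (v : F → ℂ) :
    sobolevEnergy (fun x => v (e x)) = sobolevEnergy v := by
  have h : ∀ x, ‖fderiv ℝ (fun x => v (e x)) x‖ₑ = ‖fderiv ℝ v (e x)‖ₑ := fun x => by
    have := e.toContinuousLinearEquiv.comp_right_fderiv (f := v) (x := x)
    have h2 : fderiv ℝ (fun x => v (e x)) x = (fderiv ℝ v (e x)).comp
      (e.toContinuousLinearEquiv : E →L[ℝ] F) := this
    rw [h2, enorm_eq_iff_norm_eq]
    exact (fderiv ℝ v (e x)).opNorm_comp_linearIsometryEquiv e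
  unfold sobolevEnergy
  simp_rw [h]
  congr 1
  · exact e.measurePreserving.lintegral_comp_emb e.toMeasurableEquiv.measurableEmbedding
      (fun y => ‖v y‖ₑ ^ 2)
  · exact e.measurePreserving.lintegral_comp_emb e.toMeasurableEquiv.measurableEmbedding
      (fun y => ‖fderiv ℝ v y‖ₑ ^ 2)

theorem exists_lintegral_pow_step {N : ℕ} (hN : N = 1 ∨ N = 2) :
    ∃ C : ℕ → ℝ≥0, ∀ (n : ℕ) (v : EuclideanSpace ℝ (Fin N) → ℂ), ContDiff ℝ 1 v →
      HasCompactSupport v →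
      ∫⁻ x, ‖v x‖ₑ ^ (2 * (n + 1)) ≤ C n * sobolevEnergy v * ∫⁻ x, ‖v x‖ₑ ^ (2 * n) := by
  rcases hN with rfl | rfl
  · refine ⟨fun _ => 2, fun n v hv hc => ?_⟩
    let e : ℝ ≃ₗᵢ[ℝ] EuclideanSpace ℝ (Fin 1) := (OrthonormalBasis.singleton (Fin 1) ℝ).repr
    have hb : ∀ x, ‖v x‖ₑ ^ 2 ≤ 2 * sobolevEnergy v := fun x => by
      rw [← sobolevEnergy_comp_linearIsometryEquiv e]
      simpa using enorm_sq_le_sobolevEnergy_of_real (u := fun t => v (e t))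
        (hv.comp e.contDiff) (hc.comp_homeomorph e.toHomeomorph) (e.symm x)
    have hm : Measurable (fun x => ‖v x‖ₑ ^ (2 * n)) :=
      hv.continuous.enorm.measurable.pow_const _
    rw [← lintegral_const_mul _ hm]
    refine lintegral_mono fun x => ?_
    rw [show 2 * (n + 1) = 2 + 2 * n by ring, pow_add]
    gcongr
    exact hb x
  · obtain ⟨C, hC⟩ := exists_lintegral_pow_step_of_two
    exact ⟨fun n => C * (n + 1) ^ 2, hC⟩

theorem exists_lintegral_pow_le_of_hasCompactSupport {N : ℕ} (hN : N = 1 ∨ N = 2) (n : ℕ) :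
    ∃ C : ℝ≥0, ∀ v : EuclideanSpace ℝ (Fin N) → ℂ, ContDiff ℝ 1 v → HasCompactSupport v →
      ∫⁻ x, ‖v x‖ₑ ^ (2 * (n + 1)) ≤ C * sobolevEnergy v ^ (n + 1) := by
  obtain ⟨D, hD⟩ := exists_lintegral_pow_step hN
  induction n with
  | zero => exact ⟨1, fun v _ _ => by simp [sobolevEnergy]⟩
  | succ n ih =>
    obtain ⟨C, hC⟩ := ih
    refine ⟨D (n + 1) * C, fun v hv hc => ?_⟩
    calc _ ≤ _ := hD (n + 1) v hv hc
      _ ≤ D (n + 1) * sobolevEnergy v * (C * sobolevEnergy v ^ (n + 1)) := by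
          gcongr; exact hC v hv hc
      _ = _ := by push_cast; ring

theorem exists_cutoff (E : Type*) [NormedAddCommGroup E] [InnerProductSpace ℝ E]
    [FiniteDimensional ℝ E] [MeasurableSpace E] [BorelSpace E] :
    ∃ K : ℝ≥0, ∀ v : E → ℂ, ContDiff ℝ 1 v → ∃ u : ℕ → E → ℂ,
      (∀ k, ContDiff ℝ 1 (u k) ∧ HasCompactSupport (u k) ∧
        sobolevEnergy (u k) ≤ K * sobolevEnergy v) ∧
      ∀ x, ∀ᶠ k in Filter.atTop, u k x = v x := by
  let φ : ContDiffBump (0 : E) := ⟨1, 2, one_pos, one_lt_two⟩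
  have hφ : ContDiff ℝ 1 φ := φ.contDiff
  obtain ⟨M, hM⟩ := (φ.hasCompactSupport.fderiv (𝕜 := ℝ)).exists_bound_of_continuous
    (hφ.continuous_fderiv one_ne_zero)
  have hM0 : 0 ≤ M := (norm_nonneg _).trans (hM 0)
  lift M to ℝ≥0 using hM0
  refine ⟨2 + 2 * M ^ 2, fun v hv => ?_⟩
  let c : ℕ → ℝ := fun k => ((k : ℝ) + 1)⁻¹
  have hc0 : ∀ k, 0 < c k := fun k => by positivity
  have hc1 : ∀ k, c k ≤ 1 := fun k => inv_le_one_of_one_le₀ (by linarith [k.cast_nonneg (α := ℝ)])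
  have hcut : ∀ k, ContDiff ℝ 1 (fun x : E => φ (c k • x)) := fun k =>
    hφ.comp (contDiff_const_smul (c k))
  refine ⟨fun k x => φ (c k • x) • v x, fun k => ⟨(hcut k).smul hv, ?_, ?_⟩, fun x => ?_⟩
  · have h : HasCompactSupport (fun x : E => φ (c k • x)) :=
      φ.hasCompactSupport.comp_homeomorph (Homeomorph.smulOfNeZero (c k) (hc0 k).ne')
    exact h.smul_right
  · have h0 : ∀ x, ‖φ (c k • x) • v x‖ ≤ ‖v x‖ := fun x => by
      rw [norm_smul, norm_of_nonneg φ.nonneg]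
      exact mul_le_of_le_one_left (norm_nonneg _) φ.le_one
    have h1 : ∀ x, ‖fderiv ℝ (fun x => φ (c k • x) • v x) x‖ ≤ ‖fderiv ℝ v x‖ + M * ‖v x‖ := by
      intro x
      rw [fderiv_fun_smul ((hcut k).differentiable one_ne_zero x)
        (hv.differentiable one_ne_zero x)]
      refine (norm_add_le _ _).trans (add_le_add ?_ ?_)
      · rw [norm_smul, norm_of_nonneg φ.nonneg]
        exact mul_le_of_le_one_left (norm_nonneg _) φ.le_one
      · rw [ContinuousLinearMap.norm_smulRight_apply, fderiv_comp_smul, norm_smul,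
          norm_of_nonneg (hc0 k).le]
        gcongr
        exact (mul_le_of_le_one_left (norm_nonneg _) (hc1 k)).trans (hM _)
    have h2 : ∀ x, ‖fderiv ℝ (fun x => φ (c k • x) • v x) x‖ₑ ^ 2
        ≤ 2 * ‖fderiv ℝ v x‖ₑ ^ 2 + (2 * M ^ 2 : ℝ≥0) * ‖v x‖ₑ ^ 2 := fun x => by
      have h3 : ‖fderiv ℝ (fun x => φ (c k • x) • v x) x‖₊ ^ 2
        ≤ 2 * ‖fderiv ℝ v x‖₊ ^ 2 + 2 * M ^ 2 * ‖v x‖₊ ^ 2 := by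
        rw [← NNReal.coe_le_coe]
        push_cast
        nlinarith [pow_le_pow_left₀ (norm_nonneg _) (h1 x) 2,
          sq_nonneg (‖fderiv ℝ v x‖ - M * ‖v x‖)]
      simp only [enorm_eq_nnnorm]
      exact_mod_cast h3
    have hm : Measurable (fun x => 2 * ‖fderiv ℝ v x‖ₑ ^ 2) :=
      ((hv.continuous_fderiv one_ne_zero).enorm.measurable.pow_const 2).const_mul 2
    calc sobolevEnergy (fun x => φ (c k • x) • v x)
        ≤ (∫⁻ x, ‖v x‖ₑ ^ 2) +
          ∫⁻ x, (2 * ‖fderiv ℝ v x‖ₑ ^ 2 + (2 * M ^ 2 : ℝ≥0) * ‖v x‖ₑ ^ 2) := by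
          refine add_le_add (lintegral_mono fun x => ?_) (lintegral_mono h2)
          gcongr
          exact enorm_le_iff_norm_le.2 (h0 x)
      _ = (1 + (2 * M ^ 2 : ℝ≥0)) * (∫⁻ x, ‖v x‖ₑ ^ 2) + 2 * ∫⁻ x, ‖fderiv ℝ v x‖ₑ ^ 2 := by
          rw [lintegral_add_left hm, lintegral_const_mul' _ _ ENNReal.ofNat_ne_top,
            lintegral_const_mul' _ _ ENNReal.coe_ne_top]
          ring
      _ ≤ (2 + 2 * M ^ 2 : ℝ≥0) * sobolevEnergy v := by
          rw [sobolevEnergy, mul_add]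
          gcongr
          · push_cast
            gcongr
            exact one_le_two
          · push_cast
            exact le_self_add
  · filter_upwards [Filter.eventually_ge_atTop ⌈‖x‖⌉₊] with k hk
    have hx : ‖x‖ ≤ k := (Nat.le_ceil _).trans (by exact_mod_cast hk)
    have : φ (c k • x) = 1 := by
      refine φ.one_of_mem_closedBall ?_
      rw [mem_closedBall_zero_iff, norm_smul, norm_of_nonneg (hc0 k).le]
      change ((k : ℝ) + 1)⁻¹ * ‖x‖ ≤ 1
      rw [inv_mul_le_iff₀ (by positivity)]
      linarith
    simp [this]

theorem exists_lintegral_pow_le {N : ℕ} (hN : N = 1 ∨ N = 2) (n : ℕ) :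
    ∃ C : ℝ≥0, ∀ v : EuclideanSpace ℝ (Fin N) → ℂ, ContDiff ℝ 1 v →
      ∫⁻ x, ‖v x‖ₑ ^ (2 * (n + 1)) ≤ C * sobolevEnergy v ^ (n + 1) := by
  obtain ⟨C, hC⟩ := exists_lintegral_pow_le_of_hasCompactSupport hN n
  obtain ⟨K, hK⟩ := exists_cutoff (EuclideanSpace ℝ (Fin N))
  refine ⟨C * K ^ (n + 1), fun v hv => ?_⟩
  obtain ⟨u, hu, hlim⟩ := hK v hv
  calc ∫⁻ x, ‖v x‖ₑ ^ (2 * (n + 1))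
      = ∫⁻ x, Filter.liminf (fun k => ‖u k x‖ₑ ^ (2 * (n + 1))) Filter.atTop := by
        refine lintegral_congr fun x => (Filter.Tendsto.liminf_eq ?_).symm
        refine tendsto_const_nhds.congr' ?_
        filter_upwards [hlim x] with k hk
        rw [hk]
    _ ≤ Filter.liminf (fun k => ∫⁻ x, ‖u k x‖ₑ ^ (2 * (n + 1))) Filter.atTop :=
        lintegral_liminf_le fun k => (hu k).1.continuous.enorm.measurable.pow_const _
    _ ≤ Filter.liminf (fun _ : ℕ => C * (K * sobolevEnergy v) ^ (n + 1)) Filter.atTop := by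
        refine Filter.liminf_le_liminf (Filter.Eventually.of_forall fun k => ?_)
        refine (hC (u k) (hu k).1 (hu k).2.1).trans ?_
        gcongr
        exact (hu k).2.2
    _ = _ := by
        rw [Filter.liminf_const]
        push_cast
        ring

theorem rpow_le_add_of_le {a E : ℝ≥0∞} (ha : a ≠ ∞) {p : ℝ}
    (hp : 2 ≤ p) {n : ℕ} (hn : p ≤ 2 * n) :
    a ^ p ≤ E ^ ((p - 2) / 2) * a ^ 2 + E ^ ((p - 2 * n) / 2) * a ^ (2 * n) := by
  rcases eq_or_ne a 0 with rfl | ha0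
  · simp [show 0 < p by linarith]
  have hpow : ∀ m : ℕ, a ^ p = (a ^ (2 : ℕ)) ^ ((p - m) / 2) * a ^ m := fun m => by
    rw [← ENNReal.rpow_natCast, ← ENNReal.rpow_mul, ← ENNReal.rpow_natCast,
      ← ENNReal.rpow_add _ _ ha0 ha]
    congr 1
    push_cast
    ring
  rcases le_total (a ^ 2) E with h | h
  · refine le_add_right ?_
    rw [hpow 2]
    push_cast
    gcongr
  · refine le_add_left ?_
    rw [hpow (2 * n)]
    push_cast
    gcongr ?_ * _
    rw [show (p - 2 * n) / 2 = -((2 * n - p) / 2) by ring, ENNReal.rpow_neg, ENNReal.rpow_neg]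
    gcongr

theorem exists_lintegral_rpow_le {N : ℕ} (hN : N = 1 ∨ N = 2) {p : ℝ} (hp : 2 ≤ p) :
    ∃ C : ℝ≥0, ∀ v : EuclideanSpace ℝ (Fin N) → ℂ, ContDiff ℝ 1 v → sobolevEnergy v ≠ ∞ →
      ∫⁻ x, ‖v x‖ₑ ^ p ≤ C * sobolevEnergy v ^ (p / 2) := by
  obtain ⟨n, hn⟩ := exists_nat_ge p
  obtain ⟨C, hC⟩ := exists_lintegral_pow_le hN n
  refine ⟨1 + C, fun v hv hE => ?_⟩
  have hm : Measurable (fun x => ‖v x‖ₑ ^ 2) := hv.continuous.enorm.measurable.pow_const 2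
  rcases eq_or_ne (sobolevEnergy v) 0 with hE0 | hE0
  · have h0 : ∫⁻ x, ‖v x‖ₑ ^ 2 = 0 := by
      unfold sobolevEnergy at hE0
      exact (add_eq_zero.1 hE0).1
    rw [lintegral_eq_zero_iff hm] at h0
    have : ∫⁻ x, ‖v x‖ₑ ^ p = 0 := by
      rw [lintegral_eq_zero_iff (hv.continuous.enorm.measurable.pow_const p)]
      filter_upwards [h0] with x hx
      have : v x = 0 := by simpa using hx
      simp [this, show 0 < p by linarith]
    rw [this]
    exact zero_le
  set A := sobolevEnergy v
  have hadd : ∀ s : ℝ, ∀ m : ℕ, s + m = p / 2 → A ^ s * A ^ m = A ^ (p / 2) := fun s m h => by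
    rw [← ENNReal.rpow_natCast, ← ENNReal.rpow_add _ _ hE0 hE, h]
  calc ∫⁻ x, ‖v x‖ₑ ^ p
      ≤ ∫⁻ x, (A ^ ((p - 2) / 2) * ‖v x‖ₑ ^ 2 +
          A ^ ((p - 2 * (n + 1 : ℕ)) / 2) * ‖v x‖ₑ ^ (2 * (n + 1))) :=
        lintegral_mono fun x => rpow_le_add_of_le enorm_ne_top hp
          (by push_cast; linarith)
    _ = A ^ ((p - 2) / 2) * (∫⁻ x, ‖v x‖ₑ ^ 2) +
          A ^ ((p - 2 * (n + 1 : ℕ)) / 2) * ∫⁻ x, ‖v x‖ₑ ^ (2 * (n + 1)) := by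
        rw [lintegral_add_left (hm.const_mul _),
          lintegral_const_mul' _ _ (ENNReal.rpow_ne_top_of_ne_zero hE0 hE),
          lintegral_const_mul' _ _ (ENNReal.rpow_ne_top_of_ne_zero hE0 hE)]
    _ ≤ A ^ ((p - 2) / 2) * A ^ 1 +
          A ^ ((p - 2 * (n + 1 : ℕ)) / 2) * (C * A ^ (n + 1)) := by
        gcongr
        · rw [pow_one]; exact le_self_add
        · exact hC v hv
    _ = _ := by
        rw [mul_left_comm, hadd _ 1 (by push_cast; ring), hadd _ (n + 1) (by push_cast; ring)]
        push_cast
        ring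

theorem hasDerivAt_abs_rpow_mul_self {s : ℝ} (hs : 0 < s) (x : ℝ) :
    HasDerivAt (fun t : ℝ => |t| ^ s * t) ((s + 1) * |x| ^ s) x := by
  rcases eq_or_ne x 0 with rfl | hx
  · rw [hasDerivAt_iff_tendsto_slope_zero]
    have hc : Continuous (fun t : ℝ => |t| ^ s) :=
      continuous_abs.rpow_const fun _ => Or.inr hs.le
    have h := (hc.tendsto 0).mono_left (nhdsWithin_le_nhds (s := {0}ᶜ))
    simp only [abs_zero, zero_rpow hs.ne', mul_zero] at h ⊢
    refine h.congr' ?_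
    filter_upwards [self_mem_nhdsWithin] with t ht
    have : t ≠ 0 := ht
    simp only [zero_add, smul_eq_mul]
    field_simp
    simp
  · have h := ((hasDerivAt_abs hx).rpow_const (p := s) (Or.inl (abs_ne_zero.2 hx))).mul
      (hasDerivAt_id x)
    refine h.congr_deriv ?_
    rw [rpow_sub_one (abs_ne_zero.2 hx)]
    have hsx : (SignType.sign x : ℝ) * x = |x| := sign_mul_self x
    have : |x| ≠ 0 := abs_ne_zero.2 hx
    simp only [id]
    field_simp
    linear_combination s * hsx

theorem SchwartzMap.integrable_abs_rpow_mul {E : Type*} [NormedAddCommGroup E] [NormedSpace ℝ E]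
    [MeasurableSpace E] [BorelSpace E] {μ : Measure E} (w : SchwartzMap E ℝ) {s : ℝ} (hs : 0 ≤ s)
    {g : E → ℝ} (hg : Integrable g μ) : Integrable (fun x => |w x| ^ s * g x) μ := by
  refine hg.bdd_mul (c := (SchwartzMap.seminorm ℝ 0 0 w) ^ s) ?_ (.of_forall fun x => ?_)
  · exact (w.continuous.abs.rpow_const fun _ => Or.inr hs).measurable.aestronglyMeasurable
  · rw [norm_of_nonneg (by positivity)]
    gcongr
    exact w.norm_le_seminorm ℝ x

theorem SchwartzMap.integrable_mul {E : Type*} [NormedAddCommGroup E] [NormedSpace ℝ E]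
    [FiniteDimensional ℝ E] [MeasurableSpace E] [BorelSpace E] {μ : Measure E}
    [μ.HasTemperateGrowth] (f g : SchwartzMap E ℝ) : Integrable (fun x => f x * g x) μ :=
  MemLp.integrable_mul (p := 2) (q := 2) (f.memLp 2 μ) (g.memLp 2 μ)

open scoped LineDeriv in
theorem integral_abs_rpow_mul_lap_nonpos {N : ℕ} (w : SchwartzMap (EuclideanSpace ℝ (Fin N)) ℝ)
    {s : ℝ} (hs : 0 < s) :
    Integrable (fun x => |w x| ^ s * w x * lap N (fun y => w y) x) ∧
      ∫ x, |w x| ^ s * w x * lap N (fun y => w y) x ≤ 0 := by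
  let D : Fin N → SchwartzMap (EuclideanSpace ℝ (Fin N)) ℝ := fun i => ∂_{basisVec N i} w
  have hlap : ∀ x, |w x| ^ s * w x * lap N (fun y => w y) x =
      ∑ i, |w x| ^ s * w x * fderiv ℝ (D i) x (basisVec N i) := fun x =>
    Finset.mul_sum _ _ _
  have hint : ∀ i, Integrable fun x =>
      |w x| ^ s * w x * fderiv ℝ (D i) x (basisVec N i) := fun i => by
    simp_rw [mul_assoc]
    exact w.integrable_abs_rpow_mul hs.le (w.integrable_mul (∂_{basisVec N i} (D i)))
  simp_rw [hlap]
  refine ⟨integrable_finsetSum _ fun i _ => hint i, ?_⟩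
  rw [integral_finsetSum _ fun i _ => hint i]
  refine Finset.sum_nonpos fun i _ => ?_
  have hd : ∀ x, HasFDerivAt (fun x => |w x| ^ s * w x)
      (((s + 1) * |w x| ^ s) • fderiv ℝ w x) x := fun x =>
    (hasDerivAt_abs_rpow_mul_self hs (w x)).comp_hasFDerivAt x w.differentiableAt.hasFDerivAt
  have hd' : ∀ x, fderiv ℝ (fun x => |w x| ^ s * w x) x (basisVec N i) * (D i) x =
      (s + 1) * (|w x| ^ s * ((D i) x * (D i) x)) := fun x => by
    rw [(hd x).fderiv, smul_apply, smul_eq_mul,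
      show fderiv ℝ w x (basisVec N i) = D i x from rfl]
    ring
  rw [integral_mul_fderiv_eq_neg_fderiv_mul_of_integrable ?_ (hint i) ?_
    (fun x _ => (hd x).differentiableAt) (fun x _ => (D i).differentiableAt)]
  · simp_rw [hd']
    refine neg_nonpos.2 (integral_nonneg fun x => ?_)
    have := mul_self_nonneg ((D i) x)
    positivity
  · simp_rw [hd']
    exact (w.integrable_abs_rpow_mul hs.le
      ((D i).integrable_mul (D i))).const_mul _
  · simp_rw [mul_assoc]
    exact w.integrable_abs_rpow_mul hs.le (w.integrable_mul _)

/-- The Helmholtz resolvent is a contraction on `L^p`, `p > 2`. -/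
theorem eLpNorm_le_eLpNorm_of_helmholtz {N : ℕ} (w : SchwartzMap (EuclideanSpace ℝ (Fin N)) ℝ)
    {p α : ℝ} (hp : 2 < p) {f : EuclideanSpace ℝ (Fin N) → ℝ} (hf : MemLp f (.ofReal p))
    (hw : ∀ x, w x - α ^ 2 * lap N (fun y => w y) x = f x) :
    eLpNorm w (.ofReal p) ≤ eLpNorm f (.ofReal p) := by
  have hp0 : 0 < p := by linarith
  have hp0' : ENNReal.ofReal p ≠ 0 := by simpa using hp0
  obtain ⟨hI, hneg⟩ := integral_abs_rpow_mul_lap_nonpos w (s := p - 2) (by linarith)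
  have habs : ∀ x, |w x| ^ (p - 2) * w x * w x = ‖w x‖ ^ p := fun x => by
    rcases eq_or_ne (w x) 0 with h | h
    · simp [h, hp0.ne']
    · rw [mul_assoc, ← abs_mul_abs_self, ← sq, ← rpow_natCast, ← rpow_add (abs_pos.2 h),
        norm_eq_abs]
      norm_num
  have hwp : Integrable fun x => ‖w x‖ ^ p := by
    simpa [hp0.le] using (w.memLp (.ofReal p)).integrable_norm_rpow hp0' (by simp)
  have hfp : Integrable fun x => ‖f x‖ ^ p := by
    simpa [hp0.le] using hf.integrable_norm_rpow hp0' (by simp)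
  have hq : (p / (p - 1)).HolderConjugate p := (Real.HolderConjugate.conjExponent (by linarith)).symm
  have hyoung : ∀ x, |w x| ^ (p - 2) * w x * f x ≤ (1 - 1 / p) * ‖w x‖ ^ p + 1 / p * ‖f x‖ ^ p := by
    intro x
    have h := Real.young_inequality (|w x| ^ (p - 2) * w x) (f x) hq
    have h1 : |(|w x| ^ (p - 2) * w x)| ^ (p / (p - 1)) = ‖w x‖ ^ p := by
      rw [abs_mul, abs_of_nonneg (by positivity : 0 ≤ |w x| ^ (p - 2))]
      rcases eq_or_ne (w x) 0 with h | h
      · rw [h]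
        simp [hp0.ne', (div_pos hp0 (by linarith : 0 < p - 1)).ne']
      · rw [← rpow_add_one (abs_ne_zero.2 h), ← rpow_mul (abs_nonneg _), norm_eq_abs]
        congr 1
        have : p - 1 ≠ 0 := by linarith
        field_simp
        ring
    rw [h1, ← norm_eq_abs (f x)] at h
    refine h.trans (le_of_eq ?_)
    have : p - 1 ≠ 0 := by linarith
    field_simp
  have hle : ∫ x, ‖w x‖ ^ p ≤ ∫ x, ‖f x‖ ^ p := by
    have h1 : ∀ x, |w x| ^ (p - 2) * w x * f x =
        ‖w x‖ ^ p - α ^ 2 * (|w x| ^ (p - 2) * w x * lap N (fun y => w y) x) := fun x => by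
      rw [← hw, ← habs]; ring
    have h2 := integral_mono (by simp_rw [h1]; exact hwp.sub (hI.const_mul _))
      ((hwp.const_mul (1 - 1 / p)).add (hfp.const_mul (1 / p))) hyoung
    simp only [h1, Pi.add_apply] at h2
    rw [integral_sub hwp (hI.const_mul _), integral_add (hwp.const_mul _) (hfp.const_mul _),
      integral_const_mul, integral_const_mul, integral_const_mul] at h2
    have h3 : 1 / p * ∫ x, ‖w x‖ ^ p ≤ 1 / p * ∫ x, ‖f x‖ ^ p := by
      nlinarith [sq_nonneg α]
    exact le_of_mul_le_mul_left h3 (by positivity)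
  rw [(w.memLp (.ofReal p) volume).eLpNorm_eq_integral_rpow_norm hp0' (by simp),
    hf.eLpNorm_eq_integral_rpow_norm hp0' (by simp)]
  simp only [ENNReal.toReal_ofReal hp0.le]
  gcongr

theorem SchwartzMap.sobolevEnergy_ne_top {N : ℕ} (v : SchwartzMap (EuclideanSpace ℝ (Fin N)) ℂ) :
    sobolevEnergy v ≠ ∞ := by
  have h0 := lintegral_rpow_enorm_lt_top_of_eLpNorm_lt_top two_ne_zero ENNReal.ofNat_ne_top
    (v.memLp 2 volume).2
  have h1 := lintegral_rpow_enorm_lt_top_of_eLpNorm_lt_top two_ne_zero ENNReal.ofNat_ne_top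
    ((SchwartzMap.fderivCLM ℝ (EuclideanSpace ℝ (Fin N)) ℂ v).memLp 2 volume).2
  simp only [ENNReal.toReal_ofNat, ENNReal.rpow_two] at h0 h1
  exact (ENNReal.add_lt_top.2 ⟨h0, h1⟩).ne

theorem SchwartzMap.toReal_sobolevEnergy {N : ℕ} (v : SchwartzMap (EuclideanSpace ℝ (Fin N)) ℂ) :
    (sobolevEnergy v).toReal = H1norm N v ^ 2 := by
  have hsq : ∀ {F : Type} [NormedAddCommGroup F] (f : EuclideanSpace ℝ (Fin N) → F),
      ∫⁻ x, ‖f x‖ₑ ^ 2 = eLpNorm f 2 volume ^ 2 := fun f => by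
    simpa using (eLpNorm_nnreal_pow_eq_lintegral (f := f) (μ := volume) (p := 2) two_ne_zero).symm
  have hE := v.sobolevEnergy_ne_top
  unfold sobolevEnergy at hE ⊢
  rw [H1norm, sq_sqrt (by positivity), ENNReal.toReal_add (ENNReal.add_ne_top.1 hE).1
    (ENNReal.add_ne_top.1 hE).2, hsq, hsq]
  simp [LpN, gradL2]

/-- The Sobolev embedding `H¹ ⊂ L^(pσ)` in dimension at most two, for functions of the size of
`|v|^σ`. -/
theorem exists_eLpNorm_le_of_enorm_eq_rpow {N : ℕ} (hN : N = 1 ∨ N = 2) {p σ : ℝ} (hp : 2 ≤ p)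
    (hσ : 1 ≤ σ) :
    ∃ C : ℝ≥0, ∀ v : SchwartzMap (EuclideanSpace ℝ (Fin N)) ℂ,
      ∀ {F : Type} [NormedAddCommGroup F] (f : EuclideanSpace ℝ (Fin N) → F),
      (∀ x, ‖f x‖ₑ = ‖v x‖ₑ ^ σ) →
      eLpNorm f (.ofReal p) ≤ C * sobolevEnergy v ^ (σ / 2) := by
  obtain ⟨C, hC⟩ := exists_lintegral_rpow_le hN (p := σ * p) (by nlinarith)
  have hp0 : 0 < p := by linarith
  refine ⟨C ^ (1 / p), fun v F _ f hf => ?_⟩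
  rw [eLpNorm_eq_lintegral_rpow_enorm_toReal (by simpa using hp0) ENNReal.ofReal_ne_top,
    ENNReal.toReal_ofReal hp0.le]
  simp_rw [hf, ← ENNReal.rpow_mul]
  calc _ ≤ (C * sobolevEnergy v ^ (σ * p / 2)) ^ (1 / p) := by
        gcongr
        exact hC v (v.smooth 1) v.sobolevEnergy_ne_top
    _ = _ := by
        rw [ENNReal.mul_rpow_of_nonneg _ _ (by positivity), ← ENNReal.rpow_mul,
          ENNReal.coe_rpow_of_nonneg _ (by positivity)]
        congr 2
        field_simp

theorem eLpNorm_mul_le_ofReal {X 𝕜 : Type*} [MeasurableSpace X] {μ : Measure X} [NormedRing 𝕜]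
    {f g : X → 𝕜} {p q r : ℝ} (hp : 0 < p) (hq : 0 < q) (hr : 0 < r)
    (hpqr : p⁻¹ + q⁻¹ = r⁻¹) (hf : AEStronglyMeasurable f μ) (hg : AEStronglyMeasurable g μ) :
    eLpNorm (f * g) (.ofReal r) μ ≤
      eLpNorm f (.ofReal p) μ * eLpNorm g (.ofReal q) μ := by
  have : ENNReal.HolderTriple (.ofReal p) (.ofReal q) (.ofReal r) := ⟨by
    rw [← ENNReal.ofReal_inv_of_pos hp, ← ENNReal.ofReal_inv_of_pos hq,
      ← ENNReal.ofReal_inv_of_pos hr, ← ENNReal.ofReal_add (by positivity) (by positivity), hpqr]⟩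
  simpa only [smul_eq_mul] using
    eLpNorm_smul_le_mul_eLpNorm (p := .ofReal p) (q := .ofReal q) (r := .ofReal r) hg hf

/-- (Lemma 3, case `N ≤ 2`) estimate for
`‖B(|v|^σ)|v|^{σ-1}v(v₁-v₂)‖_{r'} ≤ C_α ‖v‖_{H¹}^{2σ} ‖v₁-v₂‖_r`,
where `w = B(|v|^σ)` solves the Helmholtz equation `w - α²Δw = |v|^σ`. -/
theorem stmt1 (N : ℕ) (hN : N = 1 ∨ N = 2) (α : ℝ) (hα : 0 < α) (σ : ℝ) (hσ : 1 ≤ σ)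
    (r r' : ℝ) (hr : 2 < r) (hconj : 1 / r + 1 / r' = 1) :
    ∃ C : ℝ, 0 < C ∧
      ∀ (v : SchwartzMap (EuclideanSpace ℝ (Fin N)) ℂ)
        (w : SchwartzMap (EuclideanSpace ℝ (Fin N)) ℝ),
        (∀ x, w x - α ^ 2 * lap N (fun y => w y) x = ‖v x‖ ^ σ) →
        ∀ (v₁ v₂ : SchwartzMap (EuclideanSpace ℝ (Fin N)) ℂ),
          LpN N (fun x =>
              (w x : ℂ) * ((‖v x‖ ^ (σ - 1) : ℝ) : ℂ) * v x * (v₁ x - v₂ x)) r'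
            ≤ C * (H1norm N (fun y => v y)) ^ (2 * σ) *
                LpN N (fun x => v₁ x - v₂ x) r := by
  have hr0 : 0 < r := by linarith
  have hr2 : 0 < r - 2 := by linarith
  have hr' : r'⁻¹ = 1 - r⁻¹ := by simp only [one_div] at hconj; linarith
  have hr'0 : 0 < r' := by
    rw [← inv_pos, hr', sub_pos]
    exact inv_lt_one_of_one_lt₀ (by linarith)
  set p := 2 * r / (r - 2)
  have hp : 2 < p := by rw [lt_div_iff₀ hr2]; linarith
  have hp0 : 0 < p := by linarith
  have hpp : p⁻¹ + p⁻¹ = (p / 2)⁻¹ := by field_simp; norm_num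
  have hpr : (p / 2)⁻¹ + r⁻¹ = r'⁻¹ := by rw [hr']; simp only [p]; field_simp; ring
  obtain ⟨C, hC⟩ := exists_eLpNorm_le_of_enorm_eq_rpow hN hp.le hσ
  refine ⟨C ^ 2 + 1, by positivity, fun v w hw v₁ v₂ => ?_⟩
  have hE := v.sobolevEnergy_ne_top
  have hf : ∀ x, ‖‖v x‖ ^ σ‖ₑ = ‖v x‖ₑ ^ σ := fun x => by
    rw [Real.enorm_rpow_of_nonneg (norm_nonneg _) (by linarith), enorm_norm]
  have hg : ∀ x, ‖((‖v x‖ ^ (σ - 1) : ℝ) : ℂ) * v x‖ₑ = ‖v x‖ₑ ^ σ := fun x => by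
    rw [← hf, enorm_eq_iff_norm_eq, norm_mul, Complex.norm_real,
      norm_of_nonneg (by positivity), norm_of_nonneg (by positivity)]
    nth_rw 2 [← rpow_one ‖v x‖]
    rw [← rpow_add' (norm_nonneg _) (by linarith)]
    norm_num
  have hfc : Continuous fun x => ‖v x‖ ^ σ :=
    v.continuous.norm.rpow_const fun _ => Or.inr (by linarith)
  have hgc : Continuous fun x => ((‖v x‖ ^ (σ - 1) : ℝ) : ℂ) * v x :=
    (Complex.continuous_ofReal.comp
      (v.continuous.norm.rpow_const fun _ => Or.inr (by linarith))).mul v.continuous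
  have hwc : Continuous fun x => (w x : ℂ) := Complex.continuous_ofReal.comp w.continuous
  have hsub := v₁.continuous.sub v₂.continuous
  have hfp : MemLp (fun x => ‖v x‖ ^ σ) (.ofReal p) :=
    ⟨hfc.aestronglyMeasurable, (hC v _ hf).trans_lt (by finiteness)⟩
  have hwp : eLpNorm (fun x => (w x : ℂ)) (.ofReal p) ≤ C * sobolevEnergy v ^ (σ / 2) := by
    rw [eLpNorm_congr_norm_ae (g := w) (.of_forall fun x => Complex.norm_real _)]
    exact (eLpNorm_le_eLpNorm_of_helmholtz w hp hfp hw).trans (hC v _ hf)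
  have hwg : eLpNorm ((fun x => (w x : ℂ)) * fun x => ((‖v x‖ ^ (σ - 1) : ℝ) : ℂ) * v x)
      (.ofReal (p / 2)) ≤ (C ^ 2 : ℝ≥0) * sobolevEnergy v ^ σ := by
    refine (eLpNorm_mul_le_ofReal hp0 hp0 (half_pos hp0) hpp
      hwc.aestronglyMeasurable hgc.aestronglyMeasurable).trans ?_
    refine (mul_le_mul' hwp (hC v _ hg)).trans (le_of_eq ?_)
    rw [mul_mul_mul_comm, ← ENNReal.rpow_add_of_nonneg _ _ (by linarith) (by linarith),
      add_halves, ← sq, ENNReal.coe_pow]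
  have hmain : eLpNorm (fun x => (w x : ℂ) * ((‖v x‖ ^ (σ - 1) : ℝ) : ℂ) * v x * (v₁ x - v₂ x))
      (.ofReal r') ≤ (C ^ 2 : ℝ≥0) * sobolevEnergy v ^ σ *
        eLpNorm (fun x => v₁ x - v₂ x) (.ofReal r) := by
    have h := eLpNorm_mul_le_ofReal (half_pos hp0) hr0 hr'0 hpr
      (hwc.mul hgc).aestronglyMeasurable hsub.aestronglyMeasurable (μ := volume)
    have hassoc : (fun x => (w x : ℂ) * ((‖v x‖ ^ (σ - 1) : ℝ) : ℂ) * v x * (v₁ x - v₂ x)) =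
        ((fun x => (w x : ℂ)) * fun x => ((‖v x‖ ^ (σ - 1) : ℝ) : ℂ) * v x) * (⇑v₁ - ⇑v₂) := by
      ext x
      simp only [Pi.mul_apply, Pi.sub_apply, mul_assoc]
    rw [hassoc]
    exact h.trans (mul_le_mul_left hwg _)
  have hd : eLpNorm (fun x => v₁ x - v₂ x) (.ofReal r) ≠ ∞ :=
    ((v₁ - v₂).memLp (.ofReal r) volume).2.ne
  have hreal := ENNReal.toReal_mono (by finiteness) hmain
  rw [ENNReal.toReal_mul, ENNReal.toReal_mul, ← ENNReal.toReal_rpow, v.toReal_sobolevEnergy,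
    ENNReal.coe_toReal, ← rpow_natCast, ← rpow_mul (show 0 ≤ H1norm N v from sqrt_nonneg _)] at hreal
  push_cast at hreal
  refine hreal.trans ?_
  have h0 : 0 ≤ H1norm N v ^ (2 * σ) := rpow_nonneg (sqrt_nonneg _) _
  have h1 : 0 ≤ LpN N (fun x => v₁ x - v₂ x) r := ENNReal.toReal_nonneg
  unfold LpN at h1 ⊢
  gcongr
  linarith
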